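/- If in addition p > 2, then for every r ∈ ℝ one has (φ_n''(r))^{p/(p-2)} ≤ (p(p-1))^{p/(p-2)}·φ_n(r). -/

import Mathlib

noncomputable def phi (p : ℝ) (n : ℕ) (r : ℝ) : ℝ :=
  if |r| < n then |r| ^ p
  else (n : ℝ) ^ (p - 2) * (p * (p - 1) / 2) * (|r| - n) ^ 2
        + p * (n : ℝ) ^ (p - 1) * (|r| - n) + (n : ℝ) ^ p

open Filter Topology in
/-- Two functions that agree to first order at `a` can be glued there. -/
lemma HasDerivAt.ite_lt {f g : ℝ → ℝ} {f' g' a x : ℝ} (hf : HasDerivAt f f' x)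
    (hg : HasDerivAt g g' x) (hfg : f a = g a) (hfg' : x = a → f' = g') :
    HasDerivAt (fun y => if y < a then f y else g y) (if x < a then f' else g') x := by
  rcases lt_trichotomy x a with h | rfl | h
  · rw [if_pos h]
    refine hf.congr_of_eventuallyEq ?_
    filter_upwards [Iio_mem_nhds h] with y hy
    exact if_pos hy
  · rw [if_neg (lt_irrefl _), ← hasDerivWithinAt_univ, ← Set.Iic_union_Ici (a := x)]
    refine HasDerivWithinAt.union ?_ ?_
    · rw [← hfg' rfl]
      refine hf.hasDerivWithinAt.congr (fun y hy => ?_) ?_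
      · rcases (Set.mem_Iic.1 hy).lt_or_eq with hy | rfl
        · exact if_pos hy
        · simp [hfg]
      · simp [hfg]
    · refine hg.hasDerivWithinAt.congr (fun y hy => ?_) ?_
      · exact if_neg (not_lt.2 hy)
      · simp
  · rw [if_neg h.not_gt]
    refine hg.congr_of_eventuallyEq ?_
    filter_upwards [Ioi_mem_nhds h] with y hy
    exact if_neg (not_lt.2 (le_of_lt hy))

lemma phi_neg (p : ℝ) (n : ℕ) (r : ℝ) : phi p n (-r) = phi p n r := by
  simp [phi]

lemma deriv_deriv_phi_neg (p : ℝ) (n : ℕ) (r : ℝ) :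
    deriv (deriv (phi p n)) (-r) = deriv (deriv (phi p n)) r := by
  have h : deriv (phi p n) = fun x => -deriv (phi p n) (-x) := by
    funext x
    rw [← deriv_comp_neg]
    simp only [phi_neg]
  conv_rhs => rw [h]
  rw [deriv.fun_neg, deriv_comp_neg, neg_neg]

open Filter Topology in
lemma deriv_phi_of_pos {p : ℝ} {n : ℕ} {r : ℝ} (hr : 0 < r) :
    deriv (phi p n) r = if r < n then p * r ^ (p - 1)
      else (n : ℝ) ^ (p - 2) * (p * (p - 1)) * (r - n) + p * (n : ℝ) ^ (p - 1) := by
  have hf : HasDerivAt (fun x : ℝ => x ^ p) (p * r ^ (p - 1)) r :=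
    Real.hasDerivAt_rpow_const (Or.inl hr.ne')
  have hs : HasDerivAt (fun x : ℝ => x - n) 1 r := (hasDerivAt_id r).sub_const _
  have hg : HasDerivAt (fun x : ℝ => (n : ℝ) ^ (p - 2) * (p * (p - 1) / 2) * (x - n) ^ 2
        + p * (n : ℝ) ^ (p - 1) * (x - n) + (n : ℝ) ^ p)
      ((n : ℝ) ^ (p - 2) * (p * (p - 1)) * (r - n) + p * (n : ℝ) ^ (p - 1)) r := by
    refine ((((hs.fun_pow 2).const_mul ((n : ℝ) ^ (p - 2) * (p * (p - 1) / 2))).fun_add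
      (hs.const_mul (p * (n : ℝ) ^ (p - 1)))).add_const ((n : ℝ) ^ p)).congr_deriv ?_
    push_cast
    ring
  refine ((hf.ite_lt hg (a := n) (by simp) (by rintro rfl; simp)).congr_of_eventuallyEq ?_).deriv
  filter_upwards [Ioi_mem_nhds hr] with y hy
  simp only [phi, abs_of_pos (Set.mem_Ioi.1 hy)]

open Filter Topology in
lemma deriv_deriv_phi_of_pos {p : ℝ} {n : ℕ} {r : ℝ} (hr : 0 < r) :
    deriv (deriv (phi p n)) r = p * (p - 1) * (min r n) ^ (p - 2) := by
  have hf : HasDerivAt (fun x : ℝ => p * x ^ (p - 1)) (p * (p - 1) * r ^ (p - 2)) r := by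
    refine ((Real.hasDerivAt_rpow_const (p := p - 1) (Or.inl hr.ne')).const_mul p).congr_deriv ?_
    rw [show p - 1 - 1 = p - 2 by ring]
    ring
  have hg : HasDerivAt (fun x : ℝ => (n : ℝ) ^ (p - 2) * (p * (p - 1)) * (x - n)
      + p * (n : ℝ) ^ (p - 1)) (p * (p - 1) * (n : ℝ) ^ (p - 2)) r := by
    refine ((((hasDerivAt_id r).sub_const (n : ℝ)).const_mul
      ((n : ℝ) ^ (p - 2) * (p * (p - 1)))).add_const (p * (n : ℝ) ^ (p - 1))).congr_deriv ?_
    ring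
  have h := hf.ite_lt hg (a := n) (by simp) (by rintro rfl; rfl)
  rw [(h.congr_of_eventuallyEq (f₁ := deriv (phi p n)) ?_).deriv]
  · split_ifs with h
    · rw [min_eq_left h.le]
    · rw [min_eq_right (not_lt.1 h)]
  · filter_upwards [Ioi_mem_nhds hr] with y hy
    exact deriv_phi_of_pos hy

open Filter Topology in
lemma deriv_deriv_phi_zero {p : ℝ} (hp : 2 < p) {n : ℕ} (hn : 1 ≤ n) :
    deriv (deriv (phi p n)) 0 = 0 := by
  have hn' : (0 : ℝ) < n := by exact_mod_cast hn
  have hmem : ∀ᶠ x : ℝ in 𝓝 0, |x| < n :=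
    continuous_abs.continuousAt.eventually_lt_const (by simpa using hn')
  have hφ : deriv (phi p n) =ᶠ[𝓝 0] fun x => p * |x| ^ (p - 2) * x := by
    filter_upwards [hmem.eventually_nhds] with x hx
    refine ((hasDerivAt_abs_rpow x (by linarith)).congr_of_eventuallyEq ?_).deriv
    filter_upwards [hx] with y hy
    exact if_pos hy
  refine HasDerivAt.deriv (HasDerivAt.congr_of_eventuallyEq ?_ hφ)
  rw [hasDerivAt_iff_tendsto_slope]
  have hc : Continuous fun x : ℝ => p * |x| ^ (p - 2) :=
    continuous_const.mul (continuous_abs.rpow_const fun _ => Or.inr (by linarith))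
  have ht : Tendsto (fun x : ℝ => p * |x| ^ (p - 2)) (𝓝[≠] 0) (𝓝 0) := by
    have := hc.tendsto 0
    rw [abs_zero, Real.zero_rpow (by linarith), mul_zero] at this
    exact this.mono_left nhdsWithin_le_nhds
  refine ht.congr' ?_
  filter_upwards [self_mem_nhdsWithin] with x hx
  have hx : x ≠ 0 := hx
  simp [slope_def_field, hx]

lemma min_rpow_le_phi {p : ℝ} (hp : 1 ≤ p) {n : ℕ} {r : ℝ} (hr : 0 ≤ r) :
    (min r n) ^ p ≤ phi p n r := by
  rw [phi, abs_of_nonneg hr]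
  split_ifs with h
  · rw [min_eq_left h.le]
  · have h : (n : ℝ) ≤ r := not_lt.1 h
    have h₀ : 0 ≤ r - n := sub_nonneg.2 h
    have h₁ : 0 ≤ p - 1 := sub_nonneg.2 hp
    rw [min_eq_right h]
    exact le_add_of_nonneg_left (by positivity)

theorem phi_second_deriv_rpow_bound (p : ℝ) (hp : 2 < p) (n : ℕ) (hn : 1 ≤ n) :
    ∀ r : ℝ,
      (deriv (deriv (phi p n)) r) ^ (p / (p - 2)) ≤
        (p * (p - 1)) ^ (p / (p - 2)) * phi p n r := by
  have hp₂ : 0 < p - 2 := by linarith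
  have hp₁ : 0 < p - 1 := by linarith
  have hp₀ : 0 < p := by linarith
  have pos : ∀ r : ℝ, 0 < r → (deriv (deriv (phi p n)) r) ^ (p / (p - 2)) ≤
      (p * (p - 1)) ^ (p / (p - 2)) * phi p n r := by
    intro r hr
    have hm : 0 ≤ min r (n : ℝ) := le_min hr.le n.cast_nonneg
    rw [deriv_deriv_phi_of_pos hr, Real.mul_rpow (by positivity) (by positivity),
      ← Real.rpow_mul hm, mul_div_cancel₀ _ hp₂.ne']
    exact mul_le_mul_of_nonneg_left (min_rpow_le_phi (by linarith) hr.le) (by positivity)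
  intro r
  rcases lt_trichotomy r 0 with hr | rfl | hr
  · have := pos (-r) (neg_pos.2 hr)
    rwa [deriv_deriv_phi_neg, phi_neg] at this
  · have hn' : (0 : ℝ) < n := by exact_mod_cast hn
    rw [deriv_deriv_phi_zero hp hn, Real.zero_rpow (by positivity)]
    simp [phi, hn', Real.zero_rpow hp₀.ne']
  · exact pos r hr
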